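/- Let K be a number field of degree n_K = r_1 + 2r_2, where r_1 is the number of real embeddings and r_2 the number of conjugate pairs of complex embeddings. For a ∈ {0,1} set g_a(T) = (2/π)·Im log Γ(1/4 + a/2 + iT/2) − (T/π)·log(T/(2e)) − (2a−1)/4, and set g_K(T) = (r_1 + r_2)·g_0(T) + r_2·g_1(T). Then for all T ≥ 5/7 one has |g_K(T)| ≤ 2n_K/(50T) − r_2/(50T). -/

import Mathlib

open Complex NumberField

namespace GFB

lemma mono2 {f f' f'' : ℝ → ℝ} {h : ℝ} (hh : 0 ≤ h)
    (hf : ∀ u ∈ Set.Icc 0 h, HasDerivAt f (f' u) u)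
    (hf' : ∀ u ∈ Set.Icc 0 h, HasDerivAt f' (f'' u) u)
    (h0 : f 0 = 0) (h0' : f' 0 = 0) (hpos : ∀ u ∈ Set.Icc 0 h, 0 ≤ f'' u) : 0 ≤ f h := by
  have m1 : MonotoneOn f' (Set.Icc 0 h) := by
    apply monotoneOn_of_deriv_nonneg (convex_Icc 0 h)
    · exact fun u hu => (hf' u hu).continuousAt.continuousWithinAt
    · exact fun u hu => (hf' u (interior_subset hu)).differentiableAt.differentiableWithinAt
    · intro u hu
      rw [(hf' u (interior_subset hu)).deriv]
      exact hpos u (interior_subset hu)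
  have m2 : MonotoneOn f (Set.Icc 0 h) := by
    apply monotoneOn_of_deriv_nonneg (convex_Icc 0 h)
    · exact fun u hu => (hf u hu).continuousAt.continuousWithinAt
    · exact fun u hu => (hf u (interior_subset hu)).differentiableAt.differentiableWithinAt
    · intro u hu
      have hu' := interior_subset hu
      rw [(hf u hu').deriv, ← h0']
      exact m1 ⟨le_refl _, hh⟩ hu' hu'.1
  rw [← h0]
  exact m2 ⟨le_refl _, hh⟩ ⟨hh, le_refl _⟩ hh

/-- antiderivative of `-arctan (x/T)` -/
noncomputable def BB (T x : ℝ) : ℝ := -x * Real.arctan (x / T) + T / 2 * Real.log (x ^ 2 + T ^ 2)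

lemma hasDerivAt_arc {T : ℝ} (hT : 0 < T) (x : ℝ) :
    HasDerivAt (fun x => Real.arctan (x / T)) (T / (x ^ 2 + T ^ 2)) x := by
  have := ((hasDerivAt_id x).div_const T).arctan
  refine this.congr_deriv ?_
  simp only [id_eq]
  field_simp
  ring

lemma hasDerivAt_BB {T : ℝ} (hT : 0 < T) (x : ℝ) :
    HasDerivAt (BB T) (-Real.arctan (x / T)) x := by
  have hp : x ^ 2 + T ^ 2 ≠ 0 := by positivity
  have h1 := ((hasDerivAt_id x).neg).mul (hasDerivAt_arc hT x)
  have h2 := ((((hasDerivAt_id x).pow 2).add_const (T ^ 2)).log hp).const_mul (T / 2)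
  have h3 := h1.add h2
  refine h3.congr_deriv ?_
  simp only [id, Pi.neg_apply, Pi.pow_apply]
  field_simp
  simp
  ring

/-- midpoint error -/
noncomputable def ee (T m h : ℝ) : ℝ := BB T (m + h) - BB T (m - h) + 2 * h * Real.arctan (m / T)

noncomputable def ee1 (T m h : ℝ) : ℝ :=
  -Real.arctan ((m + h) / T) - Real.arctan ((m - h) / T) + 2 * Real.arctan (m / T)

lemma hasDerivAt_add {f : ℝ → ℝ} {f' : ℝ} (m u : ℝ) (h : HasDerivAt f f' (m + u)) :
    HasDerivAt (fun u => f (m + u)) f' u := by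
  have := h.comp u ((hasDerivAt_id u).const_add m)
  exact this.congr_deriv (by simp)

lemma hasDerivAt_sub {f : ℝ → ℝ} {f' : ℝ} (m u : ℝ) (h : HasDerivAt f f' (m - u)) :
    HasDerivAt (fun u => f (m - u)) (-f') u := by
  have := h.comp u ((hasDerivAt_id u).const_sub m)
  exact this.congr_deriv (by simp)

lemma hasDerivAt_ee {T : ℝ} (hT : 0 < T) (m u : ℝ) :
    HasDerivAt (ee T m) (ee1 T m u) u := by
  have h1 := hasDerivAt_add m u (hasDerivAt_BB hT (m + u))
  have h2 := hasDerivAt_sub m u (hasDerivAt_BB hT (m - u))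
  have h3 := ((hasDerivAt_id u).const_mul 2).mul_const (Real.arctan (m / T))
  refine ((h1.sub h2).add h3).congr_deriv ?_
  unfold ee1
  ring

lemma hasDerivAt_ee1 {T : ℝ} (hT : 0 < T) (m u : ℝ) :
    HasDerivAt (ee1 T m) (T / ((m - u) ^ 2 + T ^ 2) - T / ((m + u) ^ 2 + T ^ 2)) u := by
  have h1 := hasDerivAt_add m u (hasDerivAt_arc hT (m + u))
  have h2 := hasDerivAt_sub m u (hasDerivAt_arc hT (m - u))
  refine ((h1.neg.sub h2).add_const (2 * Real.arctan (m / T))).congr_deriv ?_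
  ring

lemma ee_nonneg {T m h : ℝ} (hT : 0 < T) (hm : 0 ≤ m) (hh : 0 ≤ h) : 0 ≤ ee T m h := by
  refine mono2 hh (fun u _ => hasDerivAt_ee hT m u) (fun u _ => hasDerivAt_ee1 hT m u) ?_ ?_ ?_
  · simp [ee]
  · simp [ee1]; ring
  · intro u hu
    rw [sub_nonneg]
    apply div_le_div_of_nonneg_left hT.le (by positivity)
    nlinarith [mul_nonneg hm hu.1]

lemma hasDerivAt_P {T : ℝ} (hT : 0 < T) (x : ℝ) :
    HasDerivAt (fun x => T / (x ^ 2 + T ^ 2)) (-(2 * T * x) / (x ^ 2 + T ^ 2) ^ 2) x := by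
  have hp : x ^ 2 + T ^ 2 ≠ 0 := by positivity
  refine (((hasDerivAt_const x T).div (((hasDerivAt_id x).pow 2).add_const (T ^ 2)) hp)).congr_deriv ?_
  simp only [id, Pi.pow_apply]
  congr 1
  simp
  ring

lemma hasDerivAt_P1 {T : ℝ} (hT : 0 < T) (x : ℝ) :
    HasDerivAt (fun x => -(2 * T * x) / (x ^ 2 + T ^ 2) ^ 2)
      (2 * T * (3 * x ^ 2 - T ^ 2) / (x ^ 2 + T ^ 2) ^ 3) x := by
  have hp : x ^ 2 + T ^ 2 ≠ 0 := by positivity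
  have hp2 : (x ^ 2 + T ^ 2) ^ 2 ≠ 0 := by positivity
  refine ((((hasDerivAt_id x).const_mul (2 * T)).neg.div
    ((((hasDerivAt_id x).pow 2).add_const (T ^ 2)).pow 2) hp2)).congr_deriv ?_
  simp only [id, Pi.pow_apply, Pi.neg_apply]
  field_simp
  simp
  ring

lemma poly_pos {q p g : ℝ} (hg : 0 ≤ g) (hp : 0 ≤ p) (hq : 9 * g ≤ q) :
    0 ≤ -96/125 * p * g^3 + 288/125 * p^2 * g^2 + 864/125 * p^3 * g + 96/25 * p^4
      - 712/375 * q * g^3 - 4728/125 * q * p * g^2 - 4136/125 * q * p^2 * g - 248/75 * q * p^3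
      + 3288/125 * q^2 * g^2 - 2864/125 * q^2 * p * g + 328/75 * q^2 * p^2
      - 5864/125 * q^3 * g + 2552/75 * q^3 * p + 1688/75 * q^4 := by
  obtain ⟨a, rfl⟩ : ∃ a, q = 9 * g + a := ⟨q - 9 * g, by ring⟩
  have ha : 0 ≤ a := by linarith
  have key : 0 ≤ p ^ 2 * (96/25 * p^2 - (22.848 * g + 248/75 * a) * p
      + (58.752 * g ^2 + 45.632 * a * g + 328/75 * a^2)) := by
    apply mul_nonneg (by positivity)
    nlinarith [sq_nonneg (p - (22.848 * g + 248/75 * a) / (192/25)), mul_nonneg ha hg,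
      sq_nonneg a, sq_nonneg g]
  have : 0 ≤ 115580.928 * g^4 + 22608.384 * p * g^3 + 54701.397 * a * g^3 + 7818.24 * a * p * g^2
     + 9697.92 * a^2 * g^2 + 895.808 * a^2 * p * g + 763.328 * a^3 * g + 34.026 * a^3 * p
     + 22.506 * a^4 := by positivity
  have h1 : 0 ≤ a * g ^ 3 := by positivity
  have h2 : 0 ≤ a ^ 3 * p := by positivity
  have h3 : 0 ≤ a ^ 4 := by positivity
  nlinarith


lemma second_nonneg {T m u : ℝ} (hT : 0 < T) (hm : 0 < m) (hu : 0 ≤ u) (hum : 3 * u ≤ m) :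
    0 ≤ (1 / 3 + 12 * (6 / 125) * u ^ 2 / m ^ 2 - 1) *
          (T / ((m - u) ^ 2 + T ^ 2) - T / ((m + u) ^ 2 + T ^ 2))
      + 2 * (u / 3 + 4 * (6 / 125) * u ^ 3 / m ^ 2) *
          (2 * T * (m - u) / ((m - u) ^ 2 + T ^ 2) ^ 2 + 2 * T * (m + u) / ((m + u) ^ 2 + T ^ 2) ^ 2)
      + (u ^ 2 / 6 + 6 / 125 * u ^ 4 / m ^ 2) *
          (2 * T * (3 * (m - u) ^ 2 - T ^ 2) / ((m - u) ^ 2 + T ^ 2) ^ 3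
            - 2 * T * (3 * (m + u) ^ 2 - T ^ 2) / ((m + u) ^ 2 + T ^ 2) ^ 3) := by
  have hA : 0 < (m + u) ^ 2 + T ^ 2 := by positivity
  have hB : 0 < (m - u) ^ 2 + T ^ 2 := by positivity
  have hpoly := poly_pos (q := m ^ 2) (p := T ^ 2) (g := u ^ 2) (by positivity) (by positivity)
    (by nlinarith)
  have : 0 ≤ T * u ^ 3 * m / (m ^ 2 * ((m - u) ^ 2 + T ^ 2) ^ 3 * ((m + u) ^ 2 + T ^ 2) ^ 3) * (
      -96/125 * T^2 * (u^2)^3 + 288/125 * (T^2)^2 * (u^2)^2 + 864/125 * (T^2)^3 * u^2 + 96/25 * (T^2)^4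
      - 712/375 * m^2 * (u^2)^3 - 4728/125 * m^2 * T^2 * (u^2)^2 - 4136/125 * m^2 * (T^2)^2 * u^2 - 248/75 * m^2 * (T^2)^3
      + 3288/125 * (m^2)^2 * (u^2)^2 - 2864/125 * (m^2)^2 * T^2 * u^2 + 328/75 * (m^2)^2 * (T^2)^2
      - 5864/125 * (m^2)^3 * u^2 + 2552/75 * (m^2)^3 * T^2 + 1688/75 * (m^2)^4) :=
    mul_nonneg (by positivity) hpoly
  refine this.trans_eq ?_
  field_simp
  ring

lemma ee_le {T m h : ℝ} (hT : 0 < T) (hm : 0 < m) (hh : 0 ≤ h) (hhm : 3 * h ≤ m) :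
    ee T m h ≤ (h ^ 2 / 6 + 6 / 125 * h ^ 4 / m ^ 2) *
      (T / ((m - h) ^ 2 + T ^ 2) - T / ((m + h) ^ 2 + T ^ 2)) := by
  rw [← sub_nonneg]
  have hw : ∀ u : ℝ, HasDerivAt (fun h => h ^ 2 / 6 + 6 / 125 * h ^ 4 / m ^ 2)
      (u / 3 + 4 * (6 / 125) * u ^ 3 / m ^ 2) u := by
    intro u
    refine ((((hasDerivAt_id u).pow 2).div_const 6).add
      ((((hasDerivAt_id u).pow 4).const_mul (6 / 125)).div_const (m ^ 2))).congr_deriv ?_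
    simp
    ring
  have hw1 : ∀ u : ℝ, HasDerivAt (fun u => u / 3 + 4 * (6 / 125) * u ^ 3 / m ^ 2)
      (1 / 3 + 12 * (6 / 125) * u ^ 2 / m ^ 2) u := by
    intro u
    refine (((hasDerivAt_id u).div_const 3).add
      ((((hasDerivAt_id u).pow 3).const_mul (4 * (6 / 125))).div_const (m ^ 2))).congr_deriv ?_
    simp
    ring
  have hD : ∀ u : ℝ, HasDerivAt
      (fun h => T / ((m - h) ^ 2 + T ^ 2) - T / ((m + h) ^ 2 + T ^ 2))
      (2 * T * (m - u) / ((m - u) ^ 2 + T ^ 2) ^ 2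
        + 2 * T * (m + u) / ((m + u) ^ 2 + T ^ 2) ^ 2) u := by
    intro u
    refine ((hasDerivAt_sub m u (hasDerivAt_P hT (m - u))).sub
      (hasDerivAt_add m u (hasDerivAt_P hT (m + u)))).congr_deriv ?_
    ring
  have hD1 : ∀ u : ℝ, HasDerivAt
      (fun u => 2 * T * (m - u) / ((m - u) ^ 2 + T ^ 2) ^ 2
        + 2 * T * (m + u) / ((m + u) ^ 2 + T ^ 2) ^ 2)
      (2 * T * (3 * (m - u) ^ 2 - T ^ 2) / ((m - u) ^ 2 + T ^ 2) ^ 3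
            - 2 * T * (3 * (m + u) ^ 2 - T ^ 2) / ((m + u) ^ 2 + T ^ 2) ^ 3) u := by
    intro u
    have := ((hasDerivAt_sub m u (hasDerivAt_P1 hT (m - u))).neg.sub
      (hasDerivAt_add m u (hasDerivAt_P1 hT (m + u))))
    refine (this.congr_deriv (by ring)).congr_of_eventuallyEq (Filter.Eventually.of_forall ?_)
    intro x
    simp only [Pi.sub_apply, Pi.neg_apply]
    ring
  refine mono2 (f := fun h => (h ^ 2 / 6 + 6 / 125 * h ^ 4 / m ^ 2) *
      (T / ((m - h) ^ 2 + T ^ 2) - T / ((m + h) ^ 2 + T ^ 2)) - ee T m h)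
    (f' := fun u => (u / 3 + 4 * (6 / 125) * u ^ 3 / m ^ 2) *
      (T / ((m - u) ^ 2 + T ^ 2) - T / ((m + u) ^ 2 + T ^ 2))
      + (u ^ 2 / 6 + 6 / 125 * u ^ 4 / m ^ 2) *
       (2 * T * (m - u) / ((m - u) ^ 2 + T ^ 2) ^ 2
        + 2 * T * (m + u) / ((m + u) ^ 2 + T ^ 2) ^ 2) - ee1 T m u) hh
    (fun u _ => ((hw u).mul (hD u)).sub (hasDerivAt_ee hT m u))
    (fun u _ => (((hw1 u).mul (hD u)).add ((hw u).mul (hD1 u))).sub (hasDerivAt_ee1 hT m u))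
    ?_ ?_ ?_
  · simp [ee]
  · simp [ee1]; ring
  · intro u hu
    refine (second_nonneg hT hm hu.1 (by linarith [hu.2])).trans_eq ?_
    ring

end GFB

namespace GFB

lemma arctan_lower {y : ℝ} (hy : 0 ≤ y) : 3 * y / (3 + y ^ 2) ≤ Real.arctan y := by
  rw [← sub_nonneg]
  have hd : ∀ u : ℝ, HasDerivAt (fun y => Real.arctan y - 3 * y / (3 + y ^ 2))
      (4 * u ^ 4 / ((1 + u ^ 2) * (3 + u ^ 2) ^ 2)) u := by
    intro u
    have hp : (3 : ℝ) + u ^ 2 ≠ 0 := by positivity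
    have hp1 : (1 : ℝ) + u ^ 2 ≠ 0 := by positivity
    refine ((hasDerivAt_id u).arctan.sub (((hasDerivAt_id u).const_mul 3).div
      (((hasDerivAt_id u).pow 2).const_add 3) hp)).congr_deriv ?_
    simp only [id_eq, Pi.pow_apply]
    field_simp
    simp
    ring
  have hm : MonotoneOn (fun y => Real.arctan y - 3 * y / (3 + y ^ 2)) Set.univ := by
    refine (monotone_of_deriv_nonneg (fun u => (hd u).differentiableAt) ?_).monotoneOn _
    intro u
    rw [(hd u).deriv]
    positivity
  have := hm (Set.mem_univ 0) (Set.mem_univ y) hy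
  simpa using this

lemma arctan_diff {x : ℝ} (hx : 0 ≤ x) :
    3 * x * (2 + x ^ 2) / (3 * x ^ 4 + 13 * x ^ 2 + 12) ≤ Real.arctan x - Real.arctan (x / 2) := by
  have h1 : Real.arctan x - Real.arctan (x / 2) = Real.arctan (x / (2 + x ^ 2)) := by
    rw [sub_eq_add_neg, ← Real.arctan_neg, Real.arctan_add (by nlinarith)]
    congr 1
    have : (1 : ℝ) - x * -(x / 2) = (2 + x ^ 2) / 2 := by ring
    rw [this]
    field_simp
    ring
  rw [h1]
  refine le_trans (le_of_eq ?_) (arctan_lower (y := x / (2 + x ^ 2)) (by positivity))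
  field_simp
  ring

lemma poly1 {s : ℝ} (h0 : 0 ≤ s) (h2 : s ≤ 2) :
    0 ≤ 6/125 + 163/125 * s - 943/1000 * s^2 - 2321/2000 * s^3 + 1713/2000 * s^4
      + 499/2000 * s^5 - 199/2000 * s^6 - 3/200 * s^7 := by
  rcases le_total s 1 with h | h
  · have hr : 0 ≤ 1 - s := by linarith
    obtain ⟨r, hrr⟩ : ∃ r, r = 1 - s := ⟨_, rfl⟩
    have h3 : 0 ≤ r := by linarith
    have e0 : 0 ≤ r^7 := by positivity
    have e1 : 0 ≤ s * r^6 := by positivity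
    have e2 : 0 ≤ s^2 * r^5 := by positivity
    have e3 : 0 ≤ s^3 * r^4 := by positivity
    have e4 : 0 ≤ s^4 * r^3 := by positivity
    have e5 : 0 ≤ s^5 * r^2 := by positivity
    have e6 : 0 ≤ s^6 * r := by positivity
    have e7 : 0 ≤ s^7 := by positivity
    rw [hrr] at e0 e1 e2 e3 e4 e5 e6
    linarith
  · obtain ⟨r, hrr⟩ : ∃ r, r = 2 - s := ⟨_, rfl⟩
    obtain ⟨t, htt⟩ : ∃ t, t = s - 1 := ⟨_, rfl⟩
    have h3 : 0 ≤ r := by linarith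
    have h4 : 0 ≤ t := by linarith
    have e0 : 0 ≤ r^7 := by positivity
    have e1 : 0 ≤ t * r^6 := by positivity
    have e2 : 0 ≤ t^2 * r^5 := by positivity
    have e3 : 0 ≤ t^3 * r^4 := by positivity
    have e4 : 0 ≤ t^4 * r^3 := by positivity
    have e5 : 0 ≤ t^5 * r^2 := by positivity
    have e6 : 0 ≤ t^6 * r := by positivity
    have e7 : 0 ≤ t^7 := by positivity
    rw [hrr, htt] at e1 e2 e3 e4 e5 e6
    rw [hrr] at e0
    rw [htt] at e7
    linarith

lemma H_nonneg {x : ℝ} (hx : 0 ≤ x) (hx2 : x ≤ 7 / 5) :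
    0 ≤ 0.0499 * x ^ 2 - 0.043 * x ^ 2 / (1 + x ^ 2) - Real.log (1 + x ^ 2) / 2
      + x * (Real.arctan x - Real.arctan (x / 2)) := by
  set M : ℝ → ℝ := fun x => (0.0499 * x ^ 2 - 0.043 * x ^ 2 / (1 + x ^ 2) - Real.log (1 + x ^ 2) / 2
      + x * (Real.arctan x - Real.arctan (x / 2))) - (0.0064 * x ^ 2 - 0.004625 * x ^ 4
        + (1 / 1200) * x ^ 6) with hM
  have hd : ∀ u : ℝ, HasDerivAt M ((0.0998 * u - 0.086 * u / (1 + u ^ 2) ^ 2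
      + (Real.arctan u - Real.arctan (u / 2)) - 2 * u / (4 + u ^ 2))
      - (0.0128 * u - 0.0185 * u ^ 3 + 0.005 * u ^ 5)) u := by
    intro u
    have hp : (1 : ℝ) + u ^ 2 ≠ 0 := by positivity
    have hp4 : (4 : ℝ) + u ^ 2 ≠ 0 := by positivity
    have i := hasDerivAt_id u
    have a1 := (i.pow 2).const_mul 0.0499
    have a2 := ((i.pow 2).const_mul 0.043).div ((i.pow 2).const_add 1) hp
    have a3 := (((i.pow 2).const_add 1).log hp).div_const 2
    have a4 := i.mul (i.arctan.sub (i.div_const 2).arctan)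
    have a5 := (((i.pow 2).const_mul 0.0064).sub ((i.pow 4).const_mul 0.004625)).add
      ((i.pow 6).const_mul (1 / 1200))
    refine ((((a1.sub a2).sub a3).add a4).sub a5).congr_deriv ?_
    simp only [id_eq, Pi.pow_apply, Pi.sub_apply]
    have : (1 : ℝ) + (u / 2) ^ 2 = (4 + u ^ 2) / 4 := by ring
    rw [this]
    field_simp
    simp
    ring
  have hm : MonotoneOn M (Set.Icc 0 (7/5)) := by
    apply monotoneOn_of_deriv_nonneg (convex_Icc _ _)
    · exact fun u hu => (hd u).continuousAt.continuousWithinAt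
    · exact fun u hu => (hd u).differentiableAt.differentiableWithinAt
    · intro u hu
      have hu' := interior_subset hu
      have hu0 := hu'.1
      have hu1 := hu'.2
      rw [(hd u).deriv]
      have h1 := arctan_diff hu0
      have h2 := poly1 (s := u ^ 2) (by positivity) (by nlinarith)
      have h3 : 0 ≤ u / ((1 + u^2)^2 * (3 * u ^ 4 + 13 * u ^ 2 + 12) * (4 + u^2)) *
        (6/125 + 163/125 * u^2 - 943/1000 * (u^2)^2 - 2321/2000 * (u^2)^3 + 1713/2000 * (u^2)^4
      + 499/2000 * (u^2)^5 - 199/2000 * (u^2)^6 - 3/200 * (u^2)^7) := mul_nonneg (by positivity) h2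
      have h4 : u / ((1 + u^2)^2 * (3 * u ^ 4 + 13 * u ^ 2 + 12) * (4 + u^2)) *
        (6/125 + 163/125 * u^2 - 943/1000 * (u^2)^2 - 2321/2000 * (u^2)^3 + 1713/2000 * (u^2)^4
      + 499/2000 * (u^2)^5 - 199/2000 * (u^2)^6 - 3/200 * (u^2)^7) =
       (0.0998 * u - 0.086 * u / (1 + u ^ 2) ^ 2
      + (3 * u * (2 + u ^ 2) / (3 * u ^ 4 + 13 * u ^ 2 + 12)) - 2 * u / (4 + u ^ 2))
      - (0.0128 * u - 0.0185 * u ^ 3 + 0.005 * u ^ 5) := by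
        have : (3 * u ^ 4 + 13 * u ^ 2 + 12) ≠ 0 := by positivity
        field_simp
        ring
      linarith
  have h5 := hm ⟨le_refl _, by norm_num⟩ ⟨hx, hx2⟩ hx
  have h6 : M 0 = 0 := by simp [hM]
  rw [h6] at h5
  have h7 : 0 ≤ 0.0064 * x ^ 2 - 0.004625 * x ^ 4 + (1 / 1200) * x ^ 6 := by
    have : 0 ≤ 0.0064 - 0.004625 * x ^ 2 + (1 / 1200) * x ^ 4 := by
      nlinarith [sq_nonneg (x ^ 2 - 49 / 25), pow_nonneg hx 2]
    nlinarith [mul_nonneg (sq_nonneg x) this]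
  simp only [hM] at h5
  linarith

lemma e0_bound {T : ℝ} (hT : 5 / 7 ≤ T) :
    ee T (1 / 2) (1 / 2) + 0.043 * (T / (1 + T ^ 2)) ≤ 0.0499 / T := by
  have hT0 : 0 < T := by linarith
  have h := H_nonneg (x := 1 / T) (by positivity) (by rw [div_le_iff₀ hT0]; linarith)
  have e1 : ee T (1 / 2) (1 / 2) = - Real.arctan (1 / T) + Real.arctan (1 / T / 2)
      + T / 2 * Real.log (1 + (1 / T) ^ 2) := by
    have : 1 + (1 / T) ^ 2 = (1 ^ 2 + T ^ 2) / T ^ 2 := by field_simp; ring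
    rw [this, Real.log_div (by positivity) (by positivity)]
    have h2 : 1 / 2 / T = 1 / T / 2 := by ring
    unfold ee BB
    rw [h2]
    norm_num
    ring
  have e2 : T * (0.0499 * (1 / T) ^ 2 - 0.043 * (1 / T) ^ 2 / (1 + (1 / T) ^ 2)
      - Real.log (1 + (1 / T) ^ 2) / 2
      + (1 / T) * (Real.arctan (1 / T) - Real.arctan ((1 / T) / 2))) =
      0.0499 / T - (ee T (1 / 2) (1 / 2) + 0.043 * (T / (1 + T ^ 2))) := by
    rw [e1]
    generalize Real.arctan (1 / T / 2) = a
    generalize Real.arctan (1 / T) = b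
    generalize Real.log (1 + (1 / T) ^ 2) = l
    have : (1 : ℝ) + T ^ 2 ≠ 0 := by positivity
    field_simp
    ring
  have := mul_nonneg hT0.le h
  rw [e2] at this
  linarith

end GFB

namespace GFB
open Filter Topology

noncomputable def CC (x T : ℝ) : ℝ := x * Real.arctan (T / x) + T / 2 * Real.log (x ^ 2 + T ^ 2)

noncomputable def ek (k : ℕ) (T : ℝ) : ℝ :=
  CC (k + 1) T - CC k T - Real.arctan (T / (k + 1 / 2))

lemma CC_eq {x T : ℝ} (hx : 0 ≤ x) (hT : 0 < T) : CC x T = BB T x + x * (Real.pi / 2) := by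
  rcases hx.eq_or_lt with rfl | hx
  · simp [CC, BB]
  · unfold CC BB
    have : T / x = (x / T)⁻¹ := by rw [inv_div]
    rw [this, Real.arctan_inv_of_pos (by positivity)]
    ring

lemma ek_eq {T : ℝ} (hT : 0 < T) (k : ℕ) : ek k T = ee T (k + 1 / 2) (1 / 2) := by
  unfold ek ee
  rw [CC_eq (by positivity) hT, CC_eq (by positivity) hT]
  have : T / ((k : ℝ) + 1 / 2) = (((k : ℝ) + 1 / 2) / T)⁻¹ := by rw [inv_div]
  rw [this, Real.arctan_inv_of_pos (by positivity)]
  have h1 : (k : ℝ) + 1 / 2 + 1 / 2 = k + 1 := by ring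
  have h2 : (k : ℝ) + 1 / 2 - 1 / 2 = k := by ring
  rw [h1, h2]
  ring

lemma ek_zero (k : ℕ) : ek k 0 = 0 := by simp [ek, CC]

lemma ek_nonneg {T : ℝ} (hT : 0 ≤ T) (k : ℕ) : 0 ≤ ek k T := by
  rcases hT.eq_or_lt with rfl | hT
  · rw [ek_zero]
  · rw [ek_eq hT]; exact ee_nonneg hT (by positivity) (by norm_num)

lemma ek_le {T : ℝ} (hT : 0 ≤ T) (k : ℕ) : ek (k + 1) T ≤
    0.043 * (T / (((k : ℝ) + 1) ^ 2 + T ^ 2)) - 0.043 * (T / ((((k + 1 : ℕ) : ℝ) + 1) ^ 2 + T ^ 2)) := by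
  rcases hT.eq_or_lt with rfl | hT
  · rw [ek_zero]; simp
  · rw [ek_eq hT]
    refine (ee_le hT (by positivity) (by norm_num) (by push_cast; linarith [k.cast_nonneg (α := ℝ)])).trans ?_
    rw [← mul_sub]
    have h1 : ((k + 1 : ℕ) : ℝ) + 1 / 2 - 1 / 2 = k + 1 := by push_cast; ring
    have h2 : ((k + 1 : ℕ) : ℝ) + 1 / 2 + 1 / 2 = ((k + 1 : ℕ) : ℝ) + 1 := by push_cast; ring
    rw [h1, h2]
    apply mul_le_mul_of_nonneg_right
    · have : (9 / 4 : ℝ) ≤ (((k + 1 : ℕ) : ℝ) + 1 / 2) ^ 2 := by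
        push_cast
        nlinarith [k.cast_nonneg (α := ℝ)]
      have h3 : 6 / 125 * (1 / 2 : ℝ) ^ 4 / (((k + 1 : ℕ) : ℝ) + 1 / 2) ^ 2 ≤
        6 / 125 * (1 / 2 : ℝ) ^ 4 / (9 / 4) := div_le_div_of_nonneg_left (by norm_num) (by norm_num) this
      norm_num at h3 ⊢
      linarith
    · rw [sub_nonneg]
      apply div_le_div_of_nonneg_left hT.le (by positivity)
      push_cast
      nlinarith [k.cast_nonneg (α := ℝ)]

lemma ek_le' {T : ℝ} (hT : 0 ≤ T) (k : ℕ) : ek (k + 1) T ≤ T * (1 / ((k : ℝ) + 1) ^ 2) := by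
  refine (ek_le hT k).trans ?_
  have h1 : 0 ≤ 0.043 * (T / ((((k + 1 : ℕ) : ℝ) + 1) ^ 2 + T ^ 2)) := by positivity
  have h2 : T / (((k : ℝ) + 1) ^ 2 + T ^ 2) ≤ T * (1 / ((k : ℝ) + 1) ^ 2) := by
    rw [mul_one_div]
    apply div_le_div_of_nonneg_left hT (by positivity)
    nlinarith [sq_nonneg T]
  have h3 : 0 ≤ T / (((k : ℝ) + 1) ^ 2 + T ^ 2) := by positivity
  linarith

lemma summable_sq : Summable (fun k : ℕ => 1 / ((k : ℝ) + 1) ^ 2) := by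
  have := (summable_nat_add_iff 1).2 (Real.summable_one_div_nat_pow.2 (one_lt_two))
  simpa using this

lemma ek_summable {T : ℝ} (hT : 0 ≤ T) : Summable (fun k => ek (k + 1) T) :=
  Summable.of_nonneg_of_le (fun _ => ek_nonneg hT _) (fun k => ek_le' hT k) (summable_sq.mul_left T)

noncomputable def FF (T : ℝ) : ℝ := ∑' k, ek (k + 1) T

lemma FF_nonneg {T : ℝ} (hT : 0 ≤ T) : 0 ≤ FF T := tsum_nonneg (fun _ => ek_nonneg hT _)

lemma FF_le {T : ℝ} (hT : 0 ≤ T) : FF T ≤ 0.043 * (T / (1 + T ^ 2)) := by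
  refine (ek_summable hT).tsum_le_of_sum_range_le ?_
  intro n
  refine (Finset.sum_le_sum (fun k _ => ek_le hT k)).trans ?_
  rw [Finset.sum_range_sub' (fun k : ℕ => 0.043 * (T / (((k : ℝ) + 1) ^ 2 + T ^ 2)))]
  have : 0 ≤ 0.043 * (T / (((n : ℝ) + 1) ^ 2 + T ^ 2)) := by positivity
  simp only [Nat.cast_zero, zero_add, one_pow]
  linarith

lemma ff_le {T : ℝ} (hT : 5 / 7 ≤ T) : ek 0 T + FF T ≤ 0.0499 / T := by
  have h := e0_bound hT
  rw [ek_eq (by linarith)]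
  have := FF_le (T := T) (by linarith)
  simp only [Nat.cast_zero, zero_add]
  linarith

lemma CC_cont (k : ℕ) : Continuous (CC k) := by
  rcases Nat.eq_zero_or_pos k with rfl | hk
  · have : CC ((0 : ℕ) : ℝ) = fun T => T * Real.log T := by
      funext T
      simp [CC]
      ring
    rw [this]
    exact Real.continuous_mul_log
  · unfold CC
    have hk' : (0 : ℝ) < k := by exact_mod_cast hk
    have h : ∀ T : ℝ, (k : ℝ) ^ 2 + T ^ 2 ≠ 0 := fun T => by positivity
    fun_prop (disch := assumption)

lemma ek_cont (k : ℕ) : Continuous (ek k) := by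
  have h1 := CC_cont (k + 1)
  have h2 := CC_cont k
  unfold ek
  push_cast at h1
  fun_prop

lemma FF_cont : ContinuousOn FF (Set.Ici 0) := by
  intro T hT
  have hT' : 0 ≤ T := hT
  have h : ContinuousOn FF (Set.Icc 0 (T + 1)) := by
    refine continuousOn_tsum (u := fun k : ℕ => (T + 1) * (1 / ((k : ℝ) + 1) ^ 2))
      (fun k => (ek_cont _).continuousOn) (summable_sq.mul_left _) ?_
    intro k x hx
    rw [Real.norm_of_nonneg (ek_nonneg hx.1 _)]
    refine (ek_le' hx.1 k).trans ?_
    exact mul_le_mul_of_nonneg_right hx.2 (by positivity)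
  refine (h T ⟨hT', by linarith⟩).mono_of_mem_nhdsWithin ?_
  rw [mem_nhdsWithin]
  exact ⟨Set.Iio (T + 1), isOpen_Iio, by simp, fun x hx => ⟨hx.2, le_of_lt hx.1⟩⟩

noncomputable def TH (T : ℝ) : ℝ := T * Real.log T - T + ek 0 T + FF T

lemma TH_cont : ContinuousOn TH (Set.Ici 0) := by
  unfold TH
  exact (((Real.continuous_mul_log.sub continuous_id).add (ek_cont 0)).continuousOn).add FF_cont

lemma TH_zero : TH 0 = 0 := by
  simp [TH, ek_zero, FF]

lemma ek_sum (T : ℝ) (n : ℕ) : ∑ k ∈ Finset.range n, ek k T =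
    CC n T - T * Real.log T - ∑ k ∈ Finset.range n, Real.arctan (T / (k + 1 / 2)) := by
  unfold ek
  rw [Finset.sum_sub_distrib]
  have := Finset.sum_range_sub (fun k : ℕ => CC k T) n
  push_cast at this
  rw [this]
  congr 2
  simp [CC]
  ring

lemma CC_tendsto (T : ℝ) : Tendsto (fun n : ℕ => CC n T - T * Real.log n) atTop (𝓝 T) := by
  have h0 : Tendsto (fun n : ℕ => T / (n : ℝ)) atTop (𝓝 0) := tendsto_const_div_atTop_nhds_zero_nat T
  have h1 : Tendsto (fun n : ℕ => (n : ℝ) * Real.arctan (T / n)) atTop (𝓝 T) := by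
    rcases eq_or_ne T 0 with rfl | hT
    · simp
    have hd := (Real.hasDerivAt_arctan 0).tendsto_slope
    have h2 : Tendsto (fun n : ℕ => T / (n : ℝ)) atTop (𝓝[≠] 0) := by
      rw [tendsto_nhdsWithin_iff]
      refine ⟨h0, ?_⟩
      filter_upwards [eventually_gt_atTop 0] with n hn
      have : (n : ℝ) ≠ 0 := by positivity
      exact div_ne_zero hT this
    have h3 := (hd.comp h2).const_mul T
    have e : (1 / (1 + (0 : ℝ) ^ 2)) = 1 := by norm_num
    rw [e, mul_one] at h3
    refine h3.congr' ?_
    filter_upwards [eventually_gt_atTop 0] with n hn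
    have : (n : ℝ) ≠ 0 := by positivity
    simp only [Function.comp, slope_def_field, Real.arctan_zero, sub_zero]
    field_simp
  have h2 : Tendsto (fun n : ℕ => T / 2 * Real.log (1 + (T / n) ^ 2)) atTop (𝓝 0) := by
    have h3 : Tendsto (fun n : ℕ => 1 + (T / (n : ℝ)) ^ 2) atTop (𝓝 1) := by
      simpa using (h0.pow 2).const_add 1
    simpa using ((Real.continuousAt_log one_ne_zero).tendsto.comp h3).const_mul (T / 2)
  have h3 := h1.add h2
  rw [add_zero] at h3
  refine h3.congr' ?_
  filter_upwards [eventually_gt_atTop 0] with n hn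
  have hn' : (0 : ℝ) < n := by positivity
  have : (1 : ℝ) + (T / n) ^ 2 = (n ^ 2 + T ^ 2) / n ^ 2 := by field_simp
  rw [this, Real.log_div (by positivity) (by positivity), Real.log_pow]
  unfold CC
  push_cast
  ring

lemma TH_tendsto {T : ℝ} (hT : 0 ≤ T) : Tendsto (fun n : ℕ => T * Real.log n -
    ∑ k ∈ Finset.range (n + 1), Real.arctan (T / (k + 1 / 2))) atTop (𝓝 (TH T)) := by
  have h1 : Tendsto (fun n : ℕ => ∑ k ∈ Finset.range n, ek k T) atTop (𝓝 (ek 0 T + FF T)) := by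
    rw [← tendsto_add_atTop_iff_nat 1]
    have := ((ek_summable hT).hasSum.tendsto_sum_nat).const_add (ek 0 T)
    refine this.congr ?_
    intro n
    rw [Finset.sum_range_succ', add_comm]
  have h2 : Tendsto (fun n : ℕ => Real.arctan (T / ((n : ℝ) + 1 / 2))) atTop (𝓝 0) := by
    have : Tendsto (fun n : ℕ => T / ((n : ℝ) + 1 / 2)) atTop (𝓝 0) :=
      Tendsto.const_div_atTop (tendsto_atTop_add_const_right _ _ tendsto_natCast_atTop_atTop) T
    simpa [Function.comp_def] using (Real.continuous_arctan.tendsto 0).comp this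
  have h3 := ((h1.sub (CC_tendsto T)).sub h2).const_add (T * Real.log T)
  have e : T * Real.log T + (ek 0 T + FF T - T - 0) = TH T := by unfold TH; ring
  rw [e] at h3
  refine h3.congr ?_
  intro n
  rw [ek_sum, Finset.sum_range_succ]
  ring

end GFB

namespace GFB
open Filter Topology

def Dir (z : ℂ) (θ : ℝ) : Prop := z = (‖z‖ : ℂ) * Complex.exp ((θ : ℂ) * Complex.I)

lemma Dir.mul {z w : ℂ} {a b : ℝ} (h1 : Dir z a) (h2 : Dir w b) : Dir (z * w) (a + b) := by
  unfold Dir at *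
  rw [norm_mul]
  push_cast
  rw [add_mul, Complex.exp_add]
  calc z * w = ((‖z‖ : ℂ) * Complex.exp ((a : ℂ) * Complex.I)) *
        ((‖w‖ : ℂ) * Complex.exp ((b : ℂ) * Complex.I)) := by rw [← h1, ← h2]
    _ = _ := by ring

lemma Dir.inv {z : ℂ} {a : ℝ} (h1 : Dir z a) : Dir (z⁻¹) (-a) := by
  unfold Dir at *
  rw [norm_inv]
  push_cast
  rw [neg_mul, Complex.exp_neg, ← mul_inv, ← h1]

lemma Dir.div {z w : ℂ} {a b : ℝ} (h1 : Dir z a) (h2 : Dir w b) : Dir (z / w) (a - b) := by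
  rw [div_eq_mul_inv, sub_eq_add_neg]
  exact h1.mul h2.inv

lemma Dir.conj {z : ℂ} {a : ℝ} (h1 : Dir z a) : Dir (starRingEnd ℂ z) (-a) := by
  unfold Dir at *
  have := congrArg (starRingEnd ℂ) h1
  rw [map_mul, ← Complex.exp_conj] at this
  simpa using this

lemma Dir_pos {r : ℝ} (hr : 0 ≤ r) : Dir (r : ℂ) 0 := by
  unfold Dir
  simp [abs_of_nonneg hr]

lemma Dir_exp (w : ℂ) : Dir (Complex.exp w) w.im := by
  unfold Dir
  rw [Complex.norm_exp]
  push_cast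
  rw [← Complex.exp_add]
  congr 1
  exact (Complex.re_add_im w).symm

lemma Dir_one_add (y : ℝ) : Dir (1 + (y : ℂ) * Complex.I) (Real.arctan y) := by
  have h : (1 + (y : ℂ) * Complex.I) = (Real.sqrt (1 + y ^ 2) : ℝ) *
      Complex.exp ((Real.arctan y : ℝ) * Complex.I) := by
    have hp : 0 < 1 + y ^ 2 := by positivity
    have hs : Real.sqrt (1 + y ^ 2) ≠ 0 := by positivity
    apply Complex.ext
    · rw [Complex.re_ofReal_mul, Complex.exp_ofReal_mul_I_re, Real.cos_arctan]
      simp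
      field_simp
    · rw [Complex.im_ofReal_mul, Complex.exp_ofReal_mul_I_im, Real.sin_arctan]
      simp
      field_simp
  rw [h]
  have := (Dir_pos (Real.sqrt_nonneg (1 + y ^ 2))).mul (Dir_exp ((Real.arctan y : ℝ) * Complex.I))
  rw [zero_add, Complex.im_ofReal_mul, Complex.I_im, mul_one] at this
  exact this

lemma Dir_add {x : ℝ} (hx : 0 < x) (y : ℝ) :
    Dir ((x : ℂ) + (y : ℂ) * Complex.I) (Real.arctan (y / x)) := by
  have := (Dir_pos hx.le).mul (Dir_one_add (y / x))
  rw [zero_add] at this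
  convert this using 1
  have : (x : ℂ) ≠ 0 := by exact_mod_cast hx.ne'
  push_cast
  field_simp

lemma Dir_prod {f : ℕ → ℂ} {θ : ℕ → ℝ} (h : ∀ n, Dir (f n) (θ n)) (n : ℕ) :
    Dir (∏ k ∈ Finset.range n, f k) (∑ k ∈ Finset.range n, θ k) := by
  induction n with
  | zero => simpa using Dir_pos zero_le_one
  | succ n ih => rw [Finset.prod_range_succ, Finset.sum_range_succ]; exact ih.mul (h n)

lemma Dir_lim {f : ℕ → ℂ} {θ : ℕ → ℝ} {z : ℂ} {a : ℝ} (h : ∀ᶠ n in atTop, Dir (f n) (θ n))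
    (hf : Tendsto f atTop (𝓝 z)) (hθ : Tendsto θ atTop (𝓝 a)) : Dir z a := by
  have h1 : Tendsto (fun n => (‖f n‖ : ℂ) * Complex.exp ((θ n : ℂ) * Complex.I)) atTop
      (𝓝 ((‖z‖ : ℂ) * Complex.exp ((a : ℂ) * Complex.I))) := by
    refine ((Complex.continuous_ofReal.tendsto _).comp hf.norm).mul ?_
    refine (Complex.continuous_exp.tendsto _).comp ?_
    exact ((Complex.continuous_ofReal.tendsto _).comp hθ).mul_const _
  refine tendsto_nhds_unique hf (h1.congr' ?_)
  filter_upwards [h] with n hn using hn.symm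

lemma Dir_cos {z : ℂ} {a b : ℝ} (hz : z ≠ 0) (h1 : Dir z a) (h2 : Dir z b) :
    Real.cos (a - b) = 1 := by
  have h := h1.div h2
  rw [div_self hz] at h
  unfold Dir at h
  rw [norm_one, Complex.ofReal_one, one_mul] at h
  rw [← Complex.exp_ofReal_mul_I_re, ← h]
  simp

lemma Dir_unique {z : ℝ → ℂ} {a b : ℝ → ℝ} (ha : ContinuousOn a (Set.Ici 0))
    (hb : ContinuousOn b (Set.Ici 0)) (h0 : a 0 = b 0) (hz : ∀ t, 0 ≤ t → z t ≠ 0)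
    (h1 : ∀ t, 0 ≤ t → Dir (z t) (a t)) (h2 : ∀ t, 0 ≤ t → Dir (z t) (b t)) {t : ℝ} (ht : 0 ≤ t) :
    a t = b t := by
  by_contra hne
  have hc : ContinuousOn (fun t => |a t - b t|) (Set.Icc 0 t) :=
    ((ha.sub hb).abs).mono Set.Icc_subset_Ici_self
  have hpos : 0 < |a t - b t| := abs_pos.2 (sub_ne_zero.2 hne)
  have hv : min |a t - b t| Real.pi ∈ Set.Icc (|a 0 - b 0|) (|a t - b t|) := by
    rw [h0, sub_self, abs_zero]
    exact ⟨le_min hpos.le Real.pi_pos.le, min_le_left _ _⟩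
  obtain ⟨s, hs, hs2⟩ := intermediate_value_Icc ht hc hv
  have hcos := Dir_cos (hz s hs.1) (h1 s hs.1) (h2 s hs.1)
  rw [← Real.cos_abs] at hcos
  simp only at hs2
  rw [hs2] at hcos
  have hlt : Real.cos (min |a t - b t| Real.pi) < Real.cos 0 :=
    Real.cos_lt_cos_of_nonneg_of_le_pi (le_refl _) (min_le_right _ _) (lt_min hpos Real.pi_pos)
  rw [Real.cos_zero] at hlt
  linarith

lemma Dir_Gamma_half {T : ℝ} (hT : 0 ≤ T) :
    Dir (Complex.Gamma (1 / 2 + (T : ℂ) * Complex.I)) (TH T) := by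
  refine Dir_lim ?_ (Complex.GammaSeq_tendsto_Gamma _) (TH_tendsto hT)
  filter_upwards [eventually_gt_atTop 0] with n hn
  unfold Complex.GammaSeq
  have hn' : (n : ℂ) ≠ 0 := by exact_mod_cast hn.ne'
  refine Dir.div ?_ ?_
  · rw [Complex.cpow_def_of_ne_zero hn', ← Complex.natCast_log]
    have h1 := Dir_exp (((Real.log n : ℝ) : ℂ) * (1 / 2 + (T : ℂ) * Complex.I))
    have h2 := h1.mul (Dir_pos (r := (n.factorial : ℝ)) (by positivity))
    have h3 : (((Real.log n : ℝ) : ℂ) * (1 / 2 + (T : ℂ) * Complex.I)).im + 0 = T * Real.log n := by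
      rw [Complex.im_ofReal_mul]
      simp
      ring
    rw [h3] at h2
    simpa using h2
  · refine Dir_prod (fun k => ?_) _
    have := Dir_add (x := (k : ℝ) + 1 / 2) (by positivity) T
    convert this using 1
    push_cast
    ring

lemma Lcont {L : ℂ → ℝ} (hc : ContinuousOn L {z : ℂ | 0 < z.re}) {σ : ℝ} (hσ : 0 < σ) :
    Continuous (fun t : ℝ => L ((σ : ℂ) + (t : ℂ) / 2 * Complex.I)) := by
  rw [← continuousOn_univ]
  refine hc.comp (by fun_prop) ?_
  intro t _
  simpa using hσ

lemma L_sum {L : ℂ → ℝ} (hc : ContinuousOn L {z : ℂ | 0 < z.re})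
    (ha : ∀ z : ℂ, 0 < z.re → Dir (Complex.Gamma z) (L z))
    (hr : ∀ x : ℝ, 0 < x → L (x : ℂ) = 0) {T : ℝ} (hT : 0 ≤ T) :
    L (((1 / 4 : ℝ) : ℂ) + (T : ℂ) / 2 * Complex.I) + L (((3 / 4 : ℝ) : ℂ) + (T : ℂ) / 2 * Complex.I)
      = TH T - T * Real.log 2 := by
  refine Dir_unique (z := fun T => Complex.Gamma (((1 / 4 : ℝ) : ℂ) + (T : ℂ) / 2 * Complex.I) *
      Complex.Gamma (((3 / 4 : ℝ) : ℂ) + (T : ℂ) / 2 * Complex.I))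
    (a := fun T => L (((1 / 4 : ℝ) : ℂ) + (T : ℂ) / 2 * Complex.I)
      + L (((3 / 4 : ℝ) : ℂ) + (T : ℂ) / 2 * Complex.I))
    (b := fun T => TH T - T * Real.log 2) ?_ ?_ ?_ ?_ ?_ ?_ hT
  · exact ((Lcont hc (by norm_num)).add (Lcont hc (by norm_num))).continuousOn
  · exact TH_cont.sub (by fun_prop)
  · have h1 := hr (1 / 4) (by norm_num)
    have h2 := hr (3 / 4) (by norm_num)
    simp only [Complex.ofReal_zero, zero_div, zero_mul, add_zero, TH_zero, h1, h2, sub_zero]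
  · intro t _
    exact mul_ne_zero (Complex.Gamma_ne_zero_of_re_pos (by simp))
      (Complex.Gamma_ne_zero_of_re_pos (by simp))
  · intro t _
    exact (ha _ (by simp)).mul (ha _ (by simp))
  · intro t ht
    have e1 : ((3 / 4 : ℝ) : ℂ) + (t : ℂ) / 2 * Complex.I =
      (((1 / 4 : ℝ) : ℂ) + (t : ℂ) / 2 * Complex.I) + 1 / 2 := by push_cast; ring
    have e2 : 2 * (((1 / 4 : ℝ) : ℂ) + (t : ℂ) / 2 * Complex.I) = 1 / 2 + (t : ℂ) * Complex.I := by
      push_cast; ring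
    rw [e1, Complex.Gamma_mul_Gamma_add_half, e2]
    have h1 : Dir ((2 : ℂ) ^ (1 - (1 / 2 + (t : ℂ) * Complex.I))) (- (t * Real.log 2)) := by
      rw [Complex.cpow_def_of_ne_zero two_ne_zero, ← Complex.ofReal_ofNat, ← Complex.ofReal_log (by norm_num)]
      have := Dir_exp (((Real.log 2 : ℝ) : ℂ) * (1 - (1 / 2 + (t : ℂ) * Complex.I)))
      have h3 : (((Real.log 2 : ℝ) : ℂ) * (1 - (1 / 2 + (t : ℂ) * Complex.I))).im = -(t * Real.log 2) := by
        rw [Complex.im_ofReal_mul]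
        simp
        ring
      rw [h3] at this
      exact this
    have h4 := ((Dir_Gamma_half ht).mul h1).mul (Dir_pos (Real.sqrt_nonneg Real.pi))
    rw [add_zero, ← sub_eq_add_neg] at h4
    exact h4

lemma L_diff {L : ℂ → ℝ} (hc : ContinuousOn L {z : ℂ | 0 < z.re})
    (ha : ∀ z : ℂ, 0 < z.re → Dir (Complex.Gamma z) (L z))
    (hr : ∀ x : ℝ, 0 < x → L (x : ℂ) = 0) {T : ℝ} (hT : 0 ≤ T) :
    L (((1 / 4 : ℝ) : ℂ) + (T : ℂ) / 2 * Complex.I) - L (((3 / 4 : ℝ) : ℂ) + (T : ℂ) / 2 * Complex.I)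
      = - Real.arctan (Real.tanh (Real.pi * (T / 2))) := by
  refine Dir_unique (z := fun T => Complex.Gamma (((1 / 4 : ℝ) : ℂ) + (T : ℂ) / 2 * Complex.I) *
      (starRingEnd ℂ) (Complex.Gamma (((3 / 4 : ℝ) : ℂ) + (T : ℂ) / 2 * Complex.I)))
    (a := fun T => L (((1 / 4 : ℝ) : ℂ) + (T : ℂ) / 2 * Complex.I)
      - L (((3 / 4 : ℝ) : ℂ) + (T : ℂ) / 2 * Complex.I))
    (b := fun T => - Real.arctan (Real.tanh (Real.pi * (T / 2)))) ?_ ?_ ?_ ?_ ?_ ?_ hT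
  · exact ((Lcont hc (by norm_num)).sub (Lcont hc (by norm_num))).continuousOn
  · apply Continuous.continuousOn
    have : Continuous Real.tanh := by
      have : Real.tanh = fun x => Real.sinh x / Real.cosh x := by
        funext x; exact Real.tanh_eq_sinh_div_cosh x
      rw [this]
      exact Real.continuous_sinh.div Real.continuous_cosh (fun x => (Real.cosh_pos x).ne')
    exact (Real.continuous_arctan.comp (this.comp (by fun_prop))).neg
  · have h1 := hr (1 / 4) (by norm_num)
    have h2 := hr (3 / 4) (by norm_num)
    simp only [Complex.ofReal_zero, zero_div, zero_mul, add_zero, h1, h2, sub_zero, mul_zero,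
      Real.tanh_zero, Real.arctan_zero, neg_zero]
  · intro t _
    refine mul_ne_zero (Complex.Gamma_ne_zero_of_re_pos (by simp)) ?_
    rw [Ne, map_eq_zero]
    exact (Complex.Gamma_ne_zero_of_re_pos (by simp))
  · intro t _
    rw [sub_eq_add_neg]
    exact (ha _ (by simp)).mul (ha _ (by simp)).conj
  · intro t ht
    rw [← Complex.Gamma_conj]
    have e1 : (starRingEnd ℂ) (((3 / 4 : ℝ) : ℂ) + (t : ℂ) / 2 * Complex.I) =
      1 - (((1 / 4 : ℝ) : ℂ) + (t : ℂ) / 2 * Complex.I) := by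
      have e0 : (t : ℂ) / 2 = ((t / 2 : ℝ) : ℂ) := by push_cast; ring
      rw [e0, map_add, map_mul, Complex.conj_ofReal, Complex.conj_ofReal, Complex.conj_I]
      push_cast
      ring
    rw [e1, Complex.Gamma_mul_Gamma_one_sub]
    have e2 : Complex.sin ((Real.pi : ℂ) * (((1 / 4 : ℝ) : ℂ) + (t : ℂ) / 2 * Complex.I)) =
       ((Real.sqrt 2 / 2 * Real.cosh (Real.pi * (t / 2)) : ℝ) : ℂ) *
        (1 + (Real.tanh (Real.pi * (t / 2)) : ℝ) * Complex.I) := by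
      have : (Real.pi : ℂ) * (((1 / 4 : ℝ) : ℂ) + (t : ℂ) / 2 * Complex.I) =
        ((Real.pi / 4 : ℝ) : ℂ) + ((Real.pi * (t / 2) : ℝ) : ℂ) * Complex.I := by push_cast; ring
      rw [this, Complex.sin_add_mul_I, ← Complex.ofReal_sin, ← Complex.ofReal_cos,
        ← Complex.ofReal_cosh, ← Complex.ofReal_sinh, Real.sin_pi_div_four, Real.cos_pi_div_four,
        Real.tanh_eq_sinh_div_cosh]
      have : ((Real.cosh (Real.pi * (t / 2)) : ℝ) : ℂ) ≠ 0 := by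
        exact_mod_cast (Real.cosh_pos _).ne'
      simp only [Complex.ofReal_div, Complex.ofReal_mul, Complex.ofReal_ofNat]
      generalize ((Real.cosh (Real.pi * (t / 2)) : ℝ) : ℂ) = c at *
      generalize ((Real.sinh (Real.pi * (t / 2)) : ℝ) : ℂ) = c' at *
      field_simp
    rw [e2]
    have hch := Real.cosh_pos (Real.pi * (t / 2))
    have := (Dir_pos Real.pi_pos.le).div
      ((Dir_pos (r := Real.sqrt 2 / 2 * Real.cosh (Real.pi * (t / 2))) (by positivity)).mul
      (Dir_one_add (Real.tanh (Real.pi * (t / 2)))))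
    rw [zero_add, zero_sub] at this
    exact this

lemma tanh_bound {x : ℝ} (hx : 0 ≤ x) :
    0 ≤ Real.pi / 4 - Real.arctan (Real.tanh x) ∧
    Real.pi / 4 - Real.arctan (Real.tanh x) ≤ Real.exp (-(2 * x)) := by
  set y := Real.exp (-(2 * x)) with hy
  have hy0 : 0 < y := Real.exp_pos _
  have hy1 : y ≤ 1 := by rw [hy]; exact Real.exp_le_one_iff.2 (by linarith)
  have ht : Real.tanh x = (1 - y) / (1 + y) := by
    rw [Real.tanh_eq]
    have e : Real.exp (-x) = Real.exp x * y := by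
      rw [hy, ← Real.exp_add]; congr 1; ring
    rw [e]
    have := Real.exp_pos x
    field_simp
  have h : Real.arctan (Real.tanh x) + Real.arctan y = Real.pi / 4 := by
    have hlt : (1 - y) / (1 + y) * y < 1 := by
      rw [div_mul_eq_mul_div, div_lt_one (by positivity)]
      nlinarith
    rw [ht, Real.arctan_add hlt, ← Real.arctan_one]
    congr 1
    have : 1 - (1 - y) / (1 + y) * y = (1 + y ^ 2) / (1 + y) := by field_simp; ring
    rw [this]
    field_simp
    ring
  have h2 : 0 ≤ Real.arctan y := by rw [← Real.arctan_zero]; exact Real.arctan_mono hy0.le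
  have h3 : Real.arctan y ≤ y := by
    have := Real.le_tan h2 (Real.arctan_lt_pi_div_two y)
    rwa [Real.tan_arctan] at this
  constructor <;> linarith

lemma exp_bound {T : ℝ} (hT : 5 / 7 ≤ T) :
    Real.exp (-(Real.pi * T)) ≤ (0.04 * Real.pi - 0.0499) / T := by
  have hT0 : 0 < T := by linarith
  have hpi := Real.pi_gt_d6
  have h1 : (9.428 : ℝ) ≤ Real.exp 2.2439 := by
    have a1 := Real.exp_one_gt_d9
    have a2 := Real.sum_le_exp_of_nonneg (x := 0.2439) (by norm_num) 5
    have a3 : Real.exp 2.2439 = Real.exp 1 * Real.exp 1 * Real.exp 0.2439 := by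
      rw [← Real.exp_add, ← Real.exp_add]; norm_num
    rw [a3]
    have a4 : (7.389 : ℝ) ≤ Real.exp 1 * Real.exp 1 := by nlinarith
    have a5 : (1.2762 : ℝ) ≤ Real.exp 0.2439 := by
      refine le_trans ?_ a2
      norm_num [Finset.sum_range_succ, Nat.factorial]
    nlinarith
  have h2 : Real.exp 2.2439 * (1 + Real.pi * (T - 5 / 7)) ≤ Real.exp (Real.pi * T) := by
    have : Real.exp (Real.pi * T) = Real.exp (Real.pi * (5 / 7)) * Real.exp (Real.pi * (T - 5 / 7)) := by
      rw [← Real.exp_add]; congr 1; ring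
    rw [this]
    apply mul_le_mul
    · apply Real.exp_le_exp.2; linarith
    · linarith [Real.add_one_le_exp (Real.pi * (T - 5 / 7))]
    · have : 0 ≤ T - 5 / 7 := by linarith
      positivity
    · positivity
  have h3 : T / (5 / 7) ≤ 1 + Real.pi * (T - 5 / 7) := by nlinarith
  have h4 : 9.428 * (T / (5 / 7)) ≤ Real.exp (Real.pi * T) := by
    refine le_trans ?_ h2
    apply mul_le_mul h1 h3 (by positivity) (by positivity)
  rw [Real.exp_neg, inv_le_comm₀ (Real.exp_pos _) (by apply div_pos _ hT0; linarith)]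
  refine le_trans ?_ h4
  rw [inv_div, div_le_iff₀ (by linarith)]
  have : T = (T / (5 / 7)) * (5 / 7) := by field_simp
  nlinarith [div_pos hT0 (show (0 : ℝ) < 5 / 7 by norm_num)]

end GFB

/-- **Bound on the gamma factor (2.6).** With `g_a(T) = (2/π) Im log Γ(1/4 + a/2 + iT/2)
- (T/π) log(T/(2e)) - (2a-1)/4` for `a ∈ {0,1}` and
`g_K(T) = (r₁ + r₂) g₀(T) + r₂ g₁(T)`, one has `|g_K(T)| ≤ 2n_K/(50T) - r₂/(50T)`
for all `T ≥ 5/7`.  Here `ImLogGamma` is the imaginary part of the principal branch of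
`log Γ`, characterised as the continuous function on the right half-plane that matches the
argument of `Γ` and vanishes on the positive real axis. -/
theorem gamma_factor_bound (K : Type*) [Field K] [NumberField K]
    (ImLogGamma : ℂ → ℝ)
    (hILGcont : ContinuousOn ImLogGamma {z : ℂ | 0 < z.re})
    (hILGarg : ∀ z : ℂ, 0 < z.re →
      Complex.Gamma z = (‖Complex.Gamma z‖ : ℂ) * Complex.exp ((ImLogGamma z : ℂ) * Complex.I))
    (hILGreal : ∀ x : ℝ, 0 < x → ImLogGamma (x : ℂ) = 0)
    (T : ℝ) (hT : 5 / 7 ≤ T) :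
    |((NumberField.InfinitePlace.nrRealPlaces K : ℝ)
        + (NumberField.InfinitePlace.nrComplexPlaces K : ℝ)) *
        (2 / Real.pi * ImLogGamma ((1 / 4 : ℂ) + 0 / 2 + (T : ℂ) / 2 * Complex.I)
          - T / Real.pi * Real.log (T / (2 * Real.exp 1)) - (2 * 0 - 1) / 4)
      + (NumberField.InfinitePlace.nrComplexPlaces K : ℝ) *
        (2 / Real.pi * ImLogGamma ((1 / 4 : ℂ) + 1 / 2 + (T : ℂ) / 2 * Complex.I)
          - T / Real.pi * Real.log (T / (2 * Real.exp 1)) - (2 * 1 - 1) / 4)|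
      ≤ 2 * (Module.finrank ℚ K : ℝ) / (50 * T)
        - (NumberField.InfinitePlace.nrComplexPlaces K : ℝ) / (50 * T) := by
  have hT0 : 0 < T := by linarith
  have hpi := Real.pi_gt_d6
  have hS := GFB.L_sum hILGcont hILGarg hILGreal hT0.le
  have hD := GFB.L_diff hILGcont hILGarg hILGreal hT0.le
  have e1 : (1 / 4 : ℂ) + 0 / 2 + (T : ℂ) / 2 * Complex.I
      = ((1 / 4 : ℝ) : ℂ) + (T : ℂ) / 2 * Complex.I := by push_cast; ring
  have e2 : (1 / 4 : ℂ) + 1 / 2 + (T : ℂ) / 2 * Complex.I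
      = ((3 / 4 : ℝ) : ℂ) + (T : ℂ) / 2 * Complex.I := by push_cast; ring
  rw [e1, e2]
  generalize ImLogGamma (((1 / 4 : ℝ) : ℂ) + (T : ℂ) / 2 * Complex.I) = A at *
  generalize ImLogGamma (((3 / 4 : ℝ) : ℂ) + (T : ℂ) / 2 * Complex.I) = B at *
  have hlog : Real.log (T / (2 * Real.exp 1)) = Real.log T - Real.log 2 - 1 := by
    rw [Real.log_div hT0.ne' (by positivity), Real.log_mul (by norm_num) (by positivity),
      Real.log_exp]
    ring
  rw [hlog]
  have hn := NumberField.InfinitePlace.card_add_two_mul_card_eq_rank K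
  have hn' : (Module.finrank ℚ K : ℝ) = (NumberField.InfinitePlace.nrRealPlaces K : ℝ)
      + 2 * (NumberField.InfinitePlace.nrComplexPlaces K : ℝ) := by
    rw [← hn]; push_cast; ring
  rw [hn']
  have hr1 : (0 : ℝ) ≤ (NumberField.InfinitePlace.nrRealPlaces K : ℝ) := Nat.cast_nonneg _
  have hr2 : (0 : ℝ) ≤ (NumberField.InfinitePlace.nrComplexPlaces K : ℝ) := Nat.cast_nonneg _
  generalize (NumberField.InfinitePlace.nrRealPlaces K : ℝ) = r1 at *
  generalize (NumberField.InfinitePlace.nrComplexPlaces K : ℝ) = r2 at *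
  obtain ⟨hd0, hd1⟩ := GFB.tanh_bound (x := Real.pi * (T / 2)) (by positivity)
  have e3 : -(2 * (Real.pi * (T / 2))) = -(Real.pi * T) := by ring
  rw [e3] at hd1
  have hd2 := hd1.trans (GFB.exp_bound hT)
  have hf1 := GFB.ff_le hT
  have hf0 : 0 ≤ GFB.ek 0 T + GFB.FF T := add_nonneg (GFB.ek_nonneg hT0.le 0) (GFB.FF_nonneg hT0.le)
  obtain ⟨d, hd⟩ : ∃ d, d = Real.pi / 4 - Real.arctan (Real.tanh (Real.pi * (T / 2))) := ⟨_, rfl⟩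
  obtain ⟨f, hf⟩ : ∃ f, f = GFB.ek 0 T + GFB.FF T := ⟨_, rfl⟩
  rw [← hd] at hd0 hd2
  rw [← hf] at hf0 hf1
  have hS' : A + B = T * Real.log T - T + f - T * Real.log 2 := by
    rw [hS, GFB.TH, hf]; ring
  have hD' : A - B = d - Real.pi / 4 := by rw [hD, hd]; ring
  have hA : 2 / Real.pi * A - T / Real.pi * (Real.log T - Real.log 2 - 1) - (2 * 0 - 1) / 4
      = (f + d) / Real.pi := by
    have : A = (T * Real.log T - T + f - T * Real.log 2 + d - Real.pi / 4) / 2 := by linarith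
    rw [this]
    field_simp
    ring
  have hB : 2 / Real.pi * B - T / Real.pi * (Real.log T - Real.log 2 - 1) - (2 * 1 - 1) / 4
      = (f - d) / Real.pi := by
    have : B = (T * Real.log T - T + f - T * Real.log 2 - d + Real.pi / 4) / 2 := by linarith
    rw [this]
    field_simp
    ring
  rw [hA, hB]
  have e4 : (r1 + r2) * ((f + d) / Real.pi) + r2 * ((f - d) / Real.pi)
      = r1 * ((f + d) / Real.pi) + r2 * (2 * f / Real.pi) := by ring
  rw [e4, abs_of_nonneg (by positivity)]
  have b1 : (f + d) / Real.pi ≤ 0.04 / T := by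
    rw [div_le_iff₀ Real.pi_pos]
    have : 0.04 / T * Real.pi = 0.0499 / T + (0.04 * Real.pi - 0.0499) / T := by ring
    linarith
  have b2 : 2 * f / Real.pi ≤ 0.06 / T := by
    rw [div_le_iff₀ Real.pi_pos]
    have : 0.06 / T * Real.pi = 2 * (0.0499 / T) + (0.06 * Real.pi - 0.0998) / T := by ring
    have h5 : 0 ≤ (0.06 * Real.pi - 0.0998) / T := div_nonneg (by linarith) hT0.le
    linarith
  have e5 : 2 * (r1 + 2 * r2) / (50 * T) - r2 / (50 * T) = r1 * (0.04 / T) + r2 * (0.06 / T) := by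
    field_simp
    ring
  rw [e5]
  exact add_le_add (mul_le_mul_of_nonneg_left b1 hr1) (mul_le_mul_of_nonneg_left b2 hr2)
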